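/- The Dirichlet Laplacian on (-1/2, 1/2) with an attractive-strength-free δ-interaction of strength γ > 0 at x = 0 (quadratic form ∫|φ'|² + γ|φ(0)|² on H¹₀((-1/2,1/2))) has a spectral gap λ₁(γ) − λ₀(γ) that behaves asymptotically like a constant times 1/γ as γ → ∞; in particular λ₁(γ) = 4π² for all γ (the first excited state is odd and vanishes at 0) while λ₀(γ) ↑ 4π² with 4π² − λ₀(γ) ≍ 1/γ. -/

import Mathlib

open MeasureTheory Filter Real Set

/-- Rayleigh quotient of the form `∫ (f')² + γ |f(0)|²` over `∫ f²` of the Dirichlet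
Laplacian on `(-1/2,1/2)` with a `δ`-interaction of strength `γ` at `0`. -/
noncomputable def rayleighDelta (γ : ℝ) (f : ℝ → ℝ) : ℝ :=
  ((∫ x in (-(1/2) : ℝ)..(1/2), (deriv f x) ^ 2) + γ * (f 0) ^ 2)
    / (∫ x in (-(1/2) : ℝ)..(1/2), (f x) ^ 2)

/-- Smooth test functions compactly supported in `(-1/2,1/2)` (a form core for
`H¹₀((-1/2,1/2))` with the `δ`-form). -/
def IsTestFunDelta (f : ℝ → ℝ) : Prop :=
  ContDiff ℝ (⊤ : ℕ∞) f ∧ tsupport f ⊆ Set.Ioo (-(1/2) : ℝ) (1/2)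

/-- `n`-th min-max eigenvalue of the Dirichlet Laplacian on `(-1/2,1/2)` with a
`δ`-interaction of strength `γ` at `0`. -/
noncomputable def deltaEV (γ : ℝ) (n : ℕ) : ℝ :=
  ⨅ W : {W : Submodule ℝ (ℝ → ℝ) //
      Module.finrank ℝ (↥W) = n + 1 ∧ ∀ f ∈ W, IsTestFunDelta f},
    ⨆ f : {f : ℝ → ℝ // f ∈ W.1 ∧ f ≠ 0}, rayleighDelta γ f.1

lemma half_aux (f : ℝ → ℝ) (hf : ContDiff ℝ 1 f) (k m : ℝ) (hk0 : 0 < k) (hk : k < 2 * π)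
    (hm0 : 0 < m) (hm : m < 1/2) (hz : ∀ x ∈ Icc m (1/2), f x = 0) :
    k^2 * (∫ x in (0:ℝ)..(1/2), (f x)^2) + k * cos (k/2) / sin (k/2) * (f 0)^2
      ≤ ∫ x in (0:ℝ)..(1/2), (deriv f x)^2 := by
  have hfc : Continuous f := hf.continuous
  have hfd : Continuous (deriv f) := hf.continuous_deriv (by norm_num)
  have hdf : ∀ x, HasDerivAt f (deriv f x) x := fun x =>
    (hf.differentiable (by norm_num)).differentiableAt.hasDerivAt
  have hs : ∀ x ∈ Icc 0 m, 0 < sin (k * (1/2 - x)) := by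
    intro x hx
    apply Real.sin_pos_of_pos_of_lt_pi
    · apply mul_pos hk0; linarith [hx.2]
    · nlinarith [hx.1, hx.2]
  set w : ℝ → ℝ := fun x => k * cos (k * (1/2 - x)) / sin (k * (1/2 - x)) with hw
  have hwd : ∀ x ∈ Icc 0 m, HasDerivAt w (k^2 + (w x)^2) x := by
    intro x hx
    have h1 : HasDerivAt (fun x : ℝ => k * (1/2 - x)) (-k) x := by
      have := ((hasDerivAt_id x).const_sub (1/2)).const_mul k
      simpa using this
    have h2 := (h1.cos.const_mul k).div h1.sin (hs x hx).ne'
    refine h2.congr_deriv ?_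
    have := (hs x hx).ne'
    have hsc := Real.sin_sq_add_cos_sq (k * (1/2 - x))
    simp only [hw]
    generalize k * (1/2 - x) = y at *
    field_simp
    ring
  have hwc : ContinuousOn w (Icc 0 m) := fun x hx => (hwd x hx).continuousAt.continuousWithinAt
  have hu : uIcc 0 m = Icc 0 m := uIcc_of_le hm0.le
  have hD : ContinuousOn (fun x => (k^2 + (w x)^2) * (f x)^2 + w x * (2 * f x * deriv f x)) (uIcc 0 m) := by
    rw [hu]
    have a1 := hfc.continuousOn (s := Icc 0 m)
    have a2 := hfd.continuousOn (s := Icc 0 m)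
    fun_prop
  have hFTC : ∫ x in (0:ℝ)..m, ((k^2 + (w x)^2) * (f x)^2 + w x * (2 * f x * deriv f x))
      = w m * (f m)^2 - w 0 * (f 0)^2 := by
    apply intervalIntegral.integral_eq_sub_of_hasDerivAt (f := fun x => w x * (f x)^2)
    · intro x hx
      rw [hu] at hx
      refine ((hwd x hx).mul ((hdf x).pow 2)).congr_deriv ?_
      norm_num
    · exact hD.intervalIntegrable
  rw [hz m ⟨le_rfl, hm.le⟩] at hFTC
  have hi1 : IntervalIntegrable (fun x => (f x)^2) volume 0 m := (by fun_prop : Continuous _).intervalIntegrable _ _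
  have hi2 : IntervalIntegrable (fun x => (deriv f x)^2) volume 0 m := (by fun_prop : Continuous _).intervalIntegrable _ _
  have hpos : 0 ≤ ∫ x in (0:ℝ)..m, ((deriv f x)^2 + ((k^2 + (w x)^2) * (f x)^2 + w x * (2 * f x * deriv f x)) - k^2 * (f x)^2) := by
    apply intervalIntegral.integral_nonneg hm0.le
    intro x _
    nlinarith [sq_nonneg (deriv f x + w x * f x)]
  rw [intervalIntegral.integral_sub (hi2.add hD.intervalIntegrable) (hi1.const_mul _),
    intervalIntegral.integral_add hi2 hD.intervalIntegrable, hFTC,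
    intervalIntegral.integral_const_mul] at hpos
  have hw0 : w 0 = k * cos (k/2) / sin (k/2) := by
    simp only [hw]; rw [show k * (1/2 - 0) = k/2 by ring]
  rw [hw0] at hpos
  have e1 : ∫ x in (0:ℝ)..(1/2), (f x)^2 = ∫ x in (0:ℝ)..m, (f x)^2 := by
    rw [← intervalIntegral.integral_add_adjacent_intervals (b := m) hi1
      ((by fun_prop : Continuous _).intervalIntegrable _ _)]
    have : ∫ x in m..(1/2), (f x)^2 = ∫ x in m..(1/2), (0:ℝ) := by
      apply intervalIntegral.integral_congr
      intro x hx
      rw [uIcc_of_le hm.le] at hx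
      simp [hz x hx]
    rw [this]; simp
  have e2 : ∫ x in (0:ℝ)..m, (deriv f x)^2 ≤ ∫ x in (0:ℝ)..(1/2), (deriv f x)^2 := by
    rw [← intervalIntegral.integral_add_adjacent_intervals (b := m) (c := 1/2) hi2
      ((by fun_prop : Continuous _).intervalIntegrable _ _)]
    have : 0 ≤ ∫ x in m..(1/2), (deriv f x)^2 :=
      intervalIntegral.integral_nonneg hm.le (fun x _ => sq_nonneg _)
    linarith
  rw [e1]
  linarith

lemma half_aux' (f : ℝ → ℝ) (hf : ContDiff ℝ 1 f) (k : ℝ) (hk0 : 0 < k) (hk : k < 2 * π)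
    (hz : (1/2 : ℝ) ∉ tsupport f) :
    k^2 * (∫ x in (0:ℝ)..(1/2), (f x)^2) + k * cos (k/2) / sin (k/2) * (f 0)^2
      ≤ ∫ x in (0:ℝ)..(1/2), (deriv f x)^2 := by
  have h1 : ∀ᶠ x in nhds (1/2 : ℝ), f x = 0 := notMem_tsupport_iff_eventuallyEq.1 hz
  obtain ⟨d, hd, h2⟩ := Metric.eventually_nhds_iff.1 h1
  have hmin : 0 < min (d/2) (1/4) := by positivity
  have ha := min_le_left (d/2) (1/4)
  have hb := min_le_right (d/2) (1/4)
  apply half_aux f hf k (1/2 - min (d/2) (1/4)) hk0 hk (by linarith) (by linarith)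
  intro x hx
  apply h2
  rw [Real.dist_eq, abs_lt]
  constructor <;> linarith [hx.1, hx.2]

lemma split_int (g : ℝ → ℝ) (hg : Continuous g) :
    ∫ x in (-(1/2) : ℝ)..(1/2), g x
      = (∫ x in (0:ℝ)..(1/2), g (-x)) + ∫ x in (0:ℝ)..(1/2), g x := by
  rw [← intervalIntegral.integral_add_adjacent_intervals (b := 0) (hg.intervalIntegrable _ _)
    (hg.intervalIntegrable _ _)]
  rw [intervalIntegral.integral_comp_neg (fun x => g x)]
  simp

lemma lower_aux (f : ℝ → ℝ) (hf : IsTestFunDelta f) (k : ℝ) (hk0 : 0 < k) (hk : k < 2 * π) :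
    k^2 * (∫ x in (-(1/2) : ℝ)..(1/2), (f x)^2) + 2 * (k * cos (k/2) / sin (k/2)) * (f 0)^2
      ≤ ∫ x in (-(1/2) : ℝ)..(1/2), (deriv f x)^2 := by
  have hf1 : ContDiff ℝ 1 f := hf.1.of_le (by exact_mod_cast le_top)
  have hfc : Continuous f := hf1.continuous
  have hfd : Continuous (deriv f) := hf1.continuous_deriv (by norm_num)
  rw [split_int (fun x => f x ^ 2) (by fun_prop), split_int (fun x => deriv f x ^ 2) (by fun_prop)]
  have r := half_aux' f hf1 k hk0 hk (fun h => by have := (hf.2 h).2; linarith)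
  have l := half_aux' (fun x => f (-x)) (hf1.comp contDiff_neg) k hk0 hk (by
    rw [notMem_tsupport_iff_eventuallyEq]
    have : (-(1/2) : ℝ) ∉ tsupport f := fun h => by have := (hf.2 h).1; linarith
    rw [notMem_tsupport_iff_eventuallyEq] at this
    exact (continuous_neg.tendsto (1/2 : ℝ)).eventually this)
  simp only [deriv_comp_neg, neg_sq, neg_zero] at l
  linarith

lemma D_pos (f : ℝ → ℝ) (hf : IsTestFunDelta f) (h0 : f ≠ 0) :
    0 < ∫ x in (-(1/2) : ℝ)..(1/2), (f x)^2 := by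
  have hfc : Continuous f := hf.1.continuous
  obtain ⟨c, hc⟩ := Function.ne_iff.1 h0
  have hc' : c ∈ Ioo (-(1/2) : ℝ) (1/2) := hf.2 (subset_tsupport _ hc)
  apply intervalIntegral.integral_pos (by norm_num) (by fun_prop) (fun x _ => sq_nonneg _)
  exact ⟨c, Ioo_subset_Icc_self hc', by have : f c ≠ 0 := hc
                                        positivity⟩

lemma E_nonneg (f : ℝ → ℝ) : 0 ≤ ∫ x in (-(1/2) : ℝ)..(1/2), (deriv f x)^2 :=
  intervalIntegral.integral_nonneg (by norm_num) (fun x _ => sq_nonneg _)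

lemma D_nonneg (f : ℝ → ℝ) : 0 ≤ ∫ x in (-(1/2) : ℝ)..(1/2), (f x)^2 :=
  intervalIntegral.integral_nonneg (by norm_num) (fun x _ => sq_nonneg _)

lemma ray_nonneg (γ : ℝ) (hγ : 0 < γ) (f : ℝ → ℝ) : 0 ≤ rayleighDelta γ f := by
  unfold rayleighDelta
  have := E_nonneg f
  have := D_nonneg f
  positivity

/-- lower bound on the Rayleigh quotient -/
lemma ray_lower (γ k : ℝ) (f : ℝ → ℝ) (hf : IsTestFunDelta f) (h0 : f ≠ 0)
    (hk0 : 0 < k) (hk : k < 2 * π) (hγ : 0 ≤ (2 * (k * cos (k/2) / sin (k/2)) + γ) * (f 0)^2) :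
    k^2 ≤ rayleighDelta γ f := by
  unfold rayleighDelta
  rw [le_div_iff₀ (D_pos f hf h0)]
  have := lower_aux f hf k hk0 hk
  linarith

lemma ray_lower_zero (γ : ℝ) (f : ℝ → ℝ) (hf : IsTestFunDelta f) (h0 : f ≠ 0) (hz : f 0 = 0) :
    4 * π^2 ≤ rayleighDelta γ f := by
  have h : ∀ k, 0 < k → k < 2 * π → k^2 ≤ rayleighDelta γ f := fun k h1 h2 =>
    ray_lower γ k f hf h0 h1 h2 (by simp [hz])
  have hpi := Real.pi_pos
  by_contra hlt
  push Not at hlt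
  have hR : 0 ≤ rayleighDelta γ f := (sq_nonneg _).trans (h π hpi (by linarith))
  have hs : √(rayleighDelta γ f) < 2 * π := by
    rw [Real.sqrt_lt' (by positivity)]; linarith
  obtain ⟨k, hk1, hk2⟩ := exists_between hs
  have hk0 := lt_of_le_of_lt (Real.sqrt_nonneg _) hk1
  have := h k hk0 hk2
  have h3 := (Real.sqrt_lt' hk0).1 hk1
  linarith

lemma ray_lower_gamma (γ : ℝ) (hγ : 8 ≤ γ) (f : ℝ → ℝ) (hf : IsTestFunDelta f) (h0 : f ≠ 0) :
    4 * π^2 - 32 * π^2 / γ ≤ rayleighDelta γ f := by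
  have hpi := Real.pi_pos
  have hγ0 : 0 < γ := by linarith
  set d := 8 * π / γ with hd
  have hd0 : 0 < d := by positivity
  have hd1 : d ≤ π := by rw [hd, div_le_iff₀ hγ0]; nlinarith
  have hk := ray_lower γ (2 * π - d) f hf h0 (by linarith) (by linarith) ?_
  · have : 32 * π^2/γ = 4 * π * d := by rw [hd]; ring
    rw [this]
    nlinarith [sq_nonneg d]
  · apply mul_nonneg _ (sq_nonneg _)
    have e : (2 * π - d)/2 = π - d/2 := by ring
    rw [e, Real.cos_pi_sub, Real.sin_pi_sub]
    have hs : 0 < sin (d/2) := Real.sin_pos_of_pos_of_lt_pi (by linarith) (by linarith)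
    have hkey : d/2 * cos (d/2) ≤ sin (d/2) := by
      rcases eq_or_lt_of_le hd1 with h | h
      · rw [h, Real.cos_pi_div_two, Real.sin_pi_div_two]; norm_num
      · have hc : 0 < cos (d/2) := Real.cos_pos_of_mem_Ioo ⟨by linarith, by linarith⟩
        have := Real.le_tan (x := d/2) (by linarith) (by linarith)
        rwa [Real.tan_eq_sin_div_cos, le_div_iff₀ hc] at this
    have hcn : 0 ≤ cos (d/2) := Real.cos_nonneg_of_mem_Icc ⟨by linarith, by linarith⟩
    have h2 : 2 * ((2 * π - d) * cos (d/2)) ≤ γ * sin (d/2) := by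
      have : γ * (d/2) = 4 * π := by rw [hd]; field_simp; ring
      have h3 : γ * (d/2 * cos (d/2)) ≤ γ * sin (d/2) := by gcongr
      have h4 : γ * (d/2 * cos (d/2)) = 4 * π * cos (d/2) := by rw [← this]; ring
      nlinarith
    have h5 : 2 * ((2 * π - d) * cos (d/2)) / sin (d/2) ≤ γ := by
      rw [div_le_iff₀ hs]; exact h2
    have h6 : 2 * ((2 * π - d) * -cos (d/2) / sin (d/2)) = -(2 * ((2 * π - d) * cos (d/2)) / sin (d/2)) := by ring
    rw [h6]; linarith

lemma exists_eta (ε : ℝ) (hε : 0 < ε) : ∃ (η : ℝ → ℝ) (δ : ℝ), 0 < δ ∧ δ < 1/4 ∧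
    ContDiff ℝ (⊤ : ℕ∞) η ∧ (∀ x ≤ δ, η x = 0) ∧ (∀ x, 1/2 - δ ≤ x → η x = 1/2) ∧
    ∀ x, 0 ≤ deriv η x ∧ deriv η x ≤ 1 + ε := by
  set r : ℝ := 1 / (4 * (1 + ε)) with hr
  have hr0 : 0 < r := by positivity
  have hr1 : r < 1/4 := by
    rw [hr, div_lt_div_iff₀ (by positivity) (by norm_num)]; linarith
  set δ : ℝ := (1/4 - r)/2 with hδ
  have hδ0 : 0 < δ := by linarith
  let φ : ContDiffBump (1/4 : ℝ) := ⟨r, 1/4 - δ, hr0, by linarith⟩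
  set b : ℝ → ℝ := φ.normed volume with hb
  have hbc : Continuous b := φ.continuous_normed
  have hbs : ∀ x, b x ≠ 0 → δ < x ∧ x < 1/2 - δ := by
    intro x hx
    have : x ∈ Function.support b := hx
    rw [hb, φ.support_normed_eq, Metric.mem_ball, Real.dist_eq, abs_lt] at this
    have h1 := this.1
    have h2 := this.2
    change -(1/4 - δ) < _ at h1
    change _ < 1/4 - δ at h2
    constructor <;> linarith
  have hder : ∀ x, HasDerivAt (fun x => 1/2 * ∫ t in (0:ℝ)..x, b t) (1/2 * b x) x := fun x =>
    (intervalIntegral.integral_hasDerivAt_right (hbc.intervalIntegrable _ _)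
      hbc.aestronglyMeasurable.stronglyMeasurableAtFilter hbc.continuousAt).const_mul _
  have hder' : deriv (fun x => 1/2 * ∫ t in (0:ℝ)..x, b t) = fun x => 1/2 * b x :=
    funext fun x => (hder x).deriv
  refine ⟨fun x => 1/2 * ∫ t in (0:ℝ)..x, b t, δ, hδ0, by linarith, ?_, ?_, ?_, ?_⟩
  · rw [contDiff_infty_iff_deriv]
    refine ⟨fun x => (hder x).differentiableAt, ?_⟩
    rw [hder']
    exact contDiff_const.mul φ.contDiff_normed
  · intro x hx
    have : ∫ t in (0:ℝ)..x, b t = ∫ t in (0:ℝ)..x, (0:ℝ) := by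
      apply intervalIntegral.integral_congr
      intro t ht
      by_contra h
      have h1 := (hbs t h).1
      rcases le_total 0 x with h0 | h0
      · rw [uIcc_of_le h0] at ht; linarith [ht.2]
      · rw [uIcc_of_ge h0] at ht; linarith [ht.2]
    simp only [this]; simp
  · intro x hx
    have : ∫ t in (0:ℝ)..x, b t = ∫ t, b t := by
      apply intervalIntegral.integral_eq_integral_of_support_subset
      intro t ht
      have := hbs t ht
      constructor <;> linarith [this.1, this.2]
    simp only [this]
    rw [hb, φ.integral_normed]; norm_num
  · intro x
    rw [hder']
    have h0 : 0 ≤ b x := φ.nonneg_normed x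
    refine ⟨by positivity, ?_⟩
    have h1 : b x ≤ 1 / volume.real (Metric.closedBall (1/4:ℝ) r) :=
      φ.normed_le_div_measure_closedBall_rIn volume x
    rw [Real.volume_real_closedBall hr0.le] at h1
    have h2 : 1 / (2 * r) = 2 * (1 + ε) := by rw [hr]; field_simp; norm_num
    rw [h2] at h1
    simp only
    linarith

lemma exists_trial (ε : ℝ) (hε : 0 < ε) : ∃ η : ℝ → ℝ, ∀ F : ℝ → ℝ, ContDiff ℝ (⊤ : ℕ∞) F →
    F (1/2) = 0 → ∀ a b c : ℝ, (b - c) * F 0 = 0 → (a - c) * F 0 = 0 →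
    let T : ℝ → ℝ := fun x => a * F (η x) + b * F (η (-x)) - c * F 0
    IsTestFunDelta T ∧ T 0 = c * F 0 ∧
    (∫ x in (-(1/2) : ℝ)..(1/2), (deriv T x)^2)
      ≤ (1 + ε) * ((a^2 + b^2) * ∫ x in (0:ℝ)..(1/2), (deriv F x)^2) ∧
    (a^2 + b^2) * (∫ x in (0:ℝ)..(1/2), (F x)^2)
      ≤ (1 + ε) * ∫ x in (-(1/2) : ℝ)..(1/2), (T x)^2 := by
  obtain ⟨η, δ, hδ0, hδ1, hη, hηl, hηr, hηd⟩ := exists_eta ε hε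
  refine ⟨η, fun F hF hF1 a b c hbc hac => ?_⟩
  intro T
  have hFd : Differentiable ℝ F := hF.differentiable (by simp)
  have hηdf : Differentiable ℝ η := hη.differentiable (by simp)
  have hFc : Continuous F := hF.continuous
  have hηc : Continuous η := hη.continuous
  have hFc' : Continuous (deriv F) := hF.continuous_deriv (by simp)
  have hηc' : Continuous (deriv η) := hη.continuous_deriv (by simp)
  have hT : ContDiff ℝ (⊤ : ℕ∞) T :=
    (((contDiff_const.mul (hF.comp hη)).add
      (contDiff_const.mul (hF.comp (hη.comp contDiff_neg)))).sub contDiff_const)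
  have hTc : Continuous T := hT.continuous
  have hTc' : Continuous (deriv T) := hT.continuous_deriv (by simp)
  have hTr : ∀ x, -δ ≤ x → T x = a * F (η x) := by
    intro x hx
    simp only [T]
    rw [hηl (-x) (by linarith)]
    linarith
  have hTl : ∀ x, -δ ≤ x → T (-x) = b * F (η x) := by
    intro x hx
    simp only [T, neg_neg]
    rw [hηl (-x) (by linarith)]
    linarith
  have hg : ∀ x, HasDerivAt (fun x => F (η x)) (deriv F (η x) * deriv η x) x := fun x =>
    (hFd (η x)).hasDerivAt.comp x (hηdf x).hasDerivAt
  have hTr' : ∀ x, 0 ≤ x → deriv T x = a * (deriv F (η x) * deriv η x) := by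
    intro x hx
    have : T =ᶠ[nhds x] fun x => a * F (η x) := by
      filter_upwards [Ioi_mem_nhds (show -δ < x by linarith)] with y hy
      exact hTr y (le_of_lt hy)
    rw [this.deriv_eq]
    exact ((hg x).const_mul a).deriv
  have hTl' : ∀ x, 0 ≤ x → deriv T (-x) = - (b * (deriv F (η x) * deriv η x)) := by
    intro x hx
    have : (fun x => T (-x)) =ᶠ[nhds x] fun x => b * F (η x) := by
      filter_upwards [Ioi_mem_nhds (show -δ < x by linarith)] with y hy
      exact hTl y (le_of_lt hy)
    have h2 := this.deriv_eq
    rw [((hg x).const_mul b).deriv, deriv_comp_neg] at h2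
    linarith
  have e0 : η 0 = 0 := hηl 0 hδ0.le
  have e1 : η (1/2) = 1/2 := hηr _ (by linarith)
  have cv : ∀ G : ℝ → ℝ, Continuous G →
      ∫ x in (0:ℝ)..(1/2), G (η x) * deriv η x = ∫ x in (0:ℝ)..(1/2), G x := by
    intro G hG
    have := intervalIntegral.integral_comp_mul_deriv (a := 0) (b := 1/2) (f := η)
      (f' := deriv η) (g := G) (fun x _ => (hηdf x).hasDerivAt) hηc'.continuousOn hG
    rw [e0, e1] at this
    exact this
  refine ⟨⟨hT, ?_⟩, ?_, ?_, ?_⟩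
  · have : tsupport T ⊆ Icc (-(1/2 - δ)) (1/2 - δ) := by
      apply closure_minimal _ isClosed_Icc
      intro x hx
      by_contra h
      apply hx
      rw [mem_Icc, not_and_or] at h
      rcases h with h | h
      · push Not at h
        have := hTl (-x) (by linarith)
        rw [neg_neg, hηr (-x) (by linarith), hF1] at this
        simpa using this
      · push Not at h
        have := hTr x (by linarith)
        rw [hηr x (by linarith), hF1] at this
        simpa using this
    exact this.trans (Icc_subset_Ioo (by linarith) (by linarith))
  · rw [hTr 0 (by linarith), e0]; linarith
  · rw [split_int (fun x => deriv T x ^ 2) (by fun_prop)]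
    have i1 : ∫ x in (0:ℝ)..(1/2), deriv T (-x) ^ 2
        = ∫ x in (0:ℝ)..(1/2), b^2 * (deriv F (η x) * deriv η x)^2 := by
      apply intervalIntegral.integral_congr
      intro x hx
      rw [uIcc_of_le (by norm_num)] at hx
      simp only [hTl' x hx.1]; ring
    have i2 : ∫ x in (0:ℝ)..(1/2), deriv T x ^ 2
        = ∫ x in (0:ℝ)..(1/2), a^2 * (deriv F (η x) * deriv η x)^2 := by
      apply intervalIntegral.integral_congr
      intro x hx
      rw [uIcc_of_le (by norm_num)] at hx
      simp only [hTr' x hx.1]; ring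
    rw [i1, i2, intervalIntegral.integral_const_mul, intervalIntegral.integral_const_mul,
      ← cv (fun x => deriv F x ^ 2) (by fun_prop)]
    have : ∫ x in (0:ℝ)..(1/2), (deriv F (η x) * deriv η x)^2
        ≤ ∫ x in (0:ℝ)..(1/2), (1 + ε) * (deriv F (η x) ^ 2 * deriv η x) := by
      apply intervalIntegral.integral_mono_on (by norm_num)
        ((by fun_prop : Continuous _).intervalIntegrable _ _)
        ((by fun_prop : Continuous _).intervalIntegrable _ _)
      intro x _
      have h1 := (hηd x).1
      have h2 := (hηd x).2
      have h3 : 0 ≤ (deriv F (η x))^2 * deriv η x := by positivity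
      nlinarith [mul_le_mul_of_nonneg_left h2 h3]
    rw [intervalIntegral.integral_const_mul] at this
    have h4 := mul_le_mul_of_nonneg_left this (by positivity : 0 ≤ a^2 + b^2)
    linarith
  · rw [split_int (fun x => T x ^ 2) (by fun_prop)]
    have i1 : ∫ x in (0:ℝ)..(1/2), T (-x) ^ 2
        = ∫ x in (0:ℝ)..(1/2), b^2 * (F (η x))^2 := by
      apply intervalIntegral.integral_congr
      intro x hx
      rw [uIcc_of_le (by norm_num)] at hx
      simp only [hTl x (by linarith [hx.1])]; ring
    have i2 : ∫ x in (0:ℝ)..(1/2), T x ^ 2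
        = ∫ x in (0:ℝ)..(1/2), a^2 * (F (η x))^2 := by
      apply intervalIntegral.integral_congr
      intro x hx
      rw [uIcc_of_le (by norm_num)] at hx
      simp only [hTr x (by linarith [hx.1])]; ring
    rw [i1, i2, intervalIntegral.integral_const_mul, intervalIntegral.integral_const_mul,
      ← cv (fun x => F x ^ 2) (by fun_prop)]
    have : ∫ x in (0:ℝ)..(1/2), F (η x) ^ 2 * deriv η x
        ≤ ∫ x in (0:ℝ)..(1/2), (1 + ε) * F (η x) ^ 2 := by
      apply intervalIntegral.integral_mono_on (by norm_num)
        ((by fun_prop : Continuous _).intervalIntegrable _ _)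
        ((by fun_prop : Continuous _).intervalIntegrable _ _)
      intro x _
      nlinarith [mul_le_mul_of_nonneg_left (hηd x).2 (sq_nonneg (F (η x)))]
    rw [intervalIntegral.integral_const_mul] at this
    have h4 := mul_le_mul_of_nonneg_left this (by positivity : 0 ≤ a^2 + b^2)
    linarith

/-- energy identity for the trial profile -/
lemma profile_energy (k : ℝ) :
    ∫ x in (0:ℝ)..(1/2), (deriv (fun x => sin (k * (1/2 - x))) x)^2
      = k^2 * (∫ x in (0:ℝ)..(1/2), (sin (k * (1/2 - x)))^2) + k * sin (k/2) * cos (k/2) := by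
  have h1 : ∀ x : ℝ, HasDerivAt (fun x : ℝ => k * (1/2 - x)) (-k) x := by
    intro x
    have := ((hasDerivAt_id x).const_sub (1/2)).const_mul k
    simpa using this
  have h2 : deriv (fun x => sin (k * (1/2 - x))) = fun x => cos (k * (1/2 - x)) * -k :=
    funext fun x => (h1 x).sin.deriv
  have h3 : ∫ x in (0:ℝ)..(1/2), ((cos (k * (1/2 - x)) * -k)^2 - k^2 * (sin (k * (1/2 - x)))^2)
      = - k * sin (k * (1/2 - 1/2)) * cos (k * (1/2 - 1/2))
        - (- k * sin (k * (1/2 - 0)) * cos (k * (1/2 - 0))) := by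
    apply intervalIntegral.integral_eq_sub_of_hasDerivAt
      (f := fun x => - k * sin (k * (1/2 - x)) * cos (k * (1/2 - x)))
    · intro x _
      refine (((h1 x).sin.const_mul (-k)).mul (h1 x).cos).congr_deriv ?_
      ring
    · exact (by fun_prop : Continuous _).intervalIntegrable _ _
  rw [intervalIntegral.integral_sub ((by fun_prop : Continuous _).intervalIntegrable _ _)
    ((by fun_prop : Continuous _).intervalIntegrable _ _),
    intervalIntegral.integral_const_mul] at h3
  rw [h2]
  simp only [sub_self, mul_zero, sin_zero, zero_mul, sub_zero] at h3
  rw [show k * (1/2) = k/2 by ring] at h3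
  linarith

lemma profile_pos (k : ℝ) (hk0 : 0 < k) (hk : k ≤ 2 * π) :
    0 < ∫ x in (0:ℝ)..(1/2), (sin (k * (1/2 - x)))^2 := by
  have hpi := Real.pi_pos
  apply intervalIntegral.integral_pos (by norm_num) (by fun_prop) (fun x _ => sq_nonneg _)
  refine ⟨1/4, ⟨by norm_num, by norm_num⟩, ?_⟩
  have : 0 < sin (k * (1/2 - 1/4)) := by
    apply Real.sin_pos_of_pos_of_lt_pi <;> nlinarith
  positivity

lemma profile_smooth (k : ℝ) : ContDiff ℝ (⊤ : ℕ∞) (fun x : ℝ => sin (k * (1/2 - x))) := by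
  fun_prop

/-- one-dimensional trial spaces -/
lemma exists_W0 (γ k ε : ℝ) (hγ : 0 < γ) (hε : 0 < ε) (hk0 : 0 < k) (hk : k ≤ 2 * π)
    (hs : sin (k/2) * (2 * k * cos (k/2) + γ * sin (k/2)) ≤ 0) :
    ∃ W : Submodule ℝ (ℝ → ℝ), Module.finrank ℝ W = 0 + 1 ∧ (∀ f ∈ W, IsTestFunDelta f) ∧
      ∀ f ∈ W, rayleighDelta γ f ≤ (1 + ε)^2 * k^2 := by
  obtain ⟨η, h⟩ := exists_trial ε hε
  set F : ℝ → ℝ := fun x => sin (k * (1/2 - x)) with hF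
  have hP := profile_pos k hk0 hk
  have hE := profile_energy k
  have hF0 : F 0 = sin (k/2) := by simp only [hF]; congr 1; ring
  have h' := fun c : ℝ => h F (profile_smooth k) (by simp [hF]) c c c (by ring) (by ring)
  set P := ∫ x in (0:ℝ)..(1/2), (F x)^2 with hPdef
  let L : ℝ →ₗ[ℝ] (ℝ → ℝ) :=
    { toFun := fun c x => c * F (η x) + c * F (η (-x)) - c * F 0
      map_add' := by intro x y; ext t; simp only [Pi.add_apply]; ring
      map_smul' := by intro x y; ext t; simp only [Pi.smul_apply, smul_eq_mul, RingHom.id_apply]; ring }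
  refine ⟨LinearMap.range L, ?_, ?_, ?_⟩
  · rw [LinearMap.finrank_range_of_inj]
    · simp
    · rw [← LinearMap.ker_eq_bot, LinearMap.ker_eq_bot']
      intro c hc
      have h4 := (h' c).2.2.2
      have : (fun x => c * F (η x) + c * F (η (-x)) - c * F 0) = 0 := hc
      rw [this] at h4
      simp at h4
      by_contra hne
      have : 0 < (c^2 + c^2) * P := by positivity
      simp [hPdef] at this
      linarith
  · rintro _ ⟨c, rfl⟩
    exact (h' c).1
  · rintro _ ⟨c, rfl⟩
    obtain ⟨-, h2, h3, h4⟩ := h' c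
    change rayleighDelta γ (fun x => c * F (η x) + c * F (η (-x)) - c * F 0) ≤ _
    generalize (fun x => c * F (η x) + c * F (η (-x)) - c * F 0) = T at h2 h3 h4 ⊢
    unfold rayleighDelta
    apply div_le_of_le_mul₀ (D_nonneg _) (by positivity)
    rw [h2, hF0]
    rw [hE] at h3
    have h5 := mul_le_mul_of_nonneg_left h4 (by positivity : 0 ≤ (1 + ε) * k^2)
    have h6 := mul_le_mul_of_nonneg_left hs (by positivity : 0 ≤ (1 + ε) * c^2)
    have h7 : 0 ≤ ε * γ * (c * sin (k/2))^2 := by positivity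
    linarith

/-- two-dimensional trial spaces -/
lemma exists_W1 (γ ε : ℝ) (hε : 0 < ε) :
    ∃ W : Submodule ℝ (ℝ → ℝ), Module.finrank ℝ W = 1 + 1 ∧ (∀ f ∈ W, IsTestFunDelta f) ∧
      ∀ f ∈ W, rayleighDelta γ f ≤ (1 + ε)^2 * (4 * π^2) := by
  obtain ⟨η, h⟩ := exists_trial ε hε
  have hpi := Real.pi_pos
  set k := 2 * π with hk
  set F : ℝ → ℝ := fun x => sin (k * (1/2 - x)) with hF
  have hP := profile_pos k (by positivity) le_rfl
  have hE := profile_energy k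
  have hks : sin (k/2) = 0 := by rw [hk, show 2 * π / 2 = π by ring, sin_pi]
  have hF0 : F 0 = 0 := by
    simp only [hF]; rw [show k * (1/2 - 0) = k/2 by ring, hks]
  have h' := fun a b : ℝ => h F (profile_smooth k) (by simp [hF]) a b 0 (by simp [hF0]) (by simp [hF0])
  set P := ∫ x in (0:ℝ)..(1/2), (F x)^2 with hPdef
  let L : ℝ × ℝ →ₗ[ℝ] (ℝ → ℝ) :=
    { toFun := fun c x => c.1 * F (η x) + c.2 * F (η (-x)) - 0 * F 0
      map_add' := by intro x y; ext t; simp only [Pi.add_apply, Prod.fst_add, Prod.snd_add]; ring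
      map_smul' := by
        intro x y; ext t
        simp only [Pi.smul_apply, smul_eq_mul, RingHom.id_apply, Prod.smul_fst, Prod.smul_snd]; ring }
  refine ⟨LinearMap.range L, ?_, ?_, ?_⟩
  · rw [LinearMap.finrank_range_of_inj]
    · simp
    · rw [← LinearMap.ker_eq_bot, LinearMap.ker_eq_bot']
      rintro ⟨a, b⟩ hc
      have h4 := (h' a b).2.2.2
      have : (fun x => a * F (η x) + b * F (η (-x)) - 0 * F 0) = 0 := hc
      rw [this] at h4
      have h5 : (a^2 + b^2) * P ≤ 0 := by simpa using h4
      have h6 : a^2 + b^2 ≤ 0 := by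
        by_contra hne
        push Not at hne
        have : 0 < (a^2 + b^2) * P := mul_pos hne hP
        linarith
      have ha : a = 0 := by nlinarith [sq_nonneg a, sq_nonneg b]
      have hb : b = 0 := by nlinarith [sq_nonneg a, sq_nonneg b]
      simp [ha, hb]
  · rintro _ ⟨c, rfl⟩
    exact (h' c.1 c.2).1
  · rintro _ ⟨c, rfl⟩
    obtain ⟨-, h2, h3, h4⟩ := h' c.1 c.2
    change rayleighDelta γ (fun x => c.1 * F (η x) + c.2 * F (η (-x)) - 0 * F 0) ≤ _
    generalize (fun x => c.1 * F (η x) + c.2 * F (η (-x)) - 0 * F 0) = T at h2 h3 h4 ⊢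
    unfold rayleighDelta
    apply div_le_of_le_mul₀ (D_nonneg _) (by positivity)
    rw [h2, hF0]
    rw [hE, hks] at h3
    have h5 := mul_le_mul_of_nonneg_left h4 (by positivity : 0 ≤ (1 + ε) * k^2)
    have h6 : k^2 = 4 * π^2 := by rw [hk]; ring
    rw [← h6]
    linarith

lemma ray_smul (γ c : ℝ) (hc : c ≠ 0) (f : ℝ → ℝ) :
    rayleighDelta γ (c • f) = rayleighDelta γ f := by
  unfold rayleighDelta
  have h1 : ∀ x, deriv (c • f) x ^ 2 = c^2 * deriv f x ^ 2 := by
    intro x; rw [deriv_const_smul_field]; simp only [smul_eq_mul]; ring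
  have h2 : ∀ x, (c • f) x ^ 2 = c^2 * f x ^ 2 := by
    intro x; simp only [Pi.smul_apply, smul_eq_mul]; ring
  simp only [h1, h2, intervalIntegral.integral_const_mul]
  rw [show ∀ A B : ℝ, c^2 * A + γ * (c^2 * B) = c^2 * (A + γ * B) by intros; ring]
  exact mul_div_mul_left _ _ (pow_ne_zero 2 hc)

lemma bdd0 (γ : ℝ) (W : Submodule ℝ (ℝ → ℝ)) (hW : Module.finrank ℝ W = 0 + 1) :
    BddAbove (range fun f : {f : ℝ → ℝ // f ∈ W ∧ f ≠ 0} => rayleighDelta γ f.1) := by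
  obtain ⟨v, hv, h⟩ := finrank_eq_one_iff'.1 hW
  refine ⟨rayleighDelta γ v.1, ?_⟩
  rintro _ ⟨⟨f, hf, hf0⟩, rfl⟩
  obtain ⟨c, hc⟩ := h ⟨f, hf⟩
  have hc' : c • v.1 = f := congrArg Subtype.val hc
  have : c ≠ 0 := by
    rintro rfl
    apply hf0
    rw [← hc', zero_smul]
  simp only
  rw [← hc', ray_smul γ c this]

lemma quad_expand (u v : ℝ → ℝ) (hu : Continuous u) (hv : Continuous v) (a b : ℝ) :
    ∫ x in (-(1/2) : ℝ)..(1/2), (a * u x + b * v x)^2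
      = a^2 * (∫ x in (-(1/2) : ℝ)..(1/2), (u x)^2)
        + 2 * a * b * (∫ x in (-(1/2) : ℝ)..(1/2), u x * v x)
        + b^2 * (∫ x in (-(1/2) : ℝ)..(1/2), (v x)^2) := by
  rw [← intervalIntegral.integral_const_mul, ← intervalIntegral.integral_const_mul,
    ← intervalIntegral.integral_const_mul,
    ← intervalIntegral.integral_add ((by fun_prop : Continuous _).intervalIntegrable _ _)
      ((by fun_prop : Continuous _).intervalIntegrable _ _),
    ← intervalIntegral.integral_add ((by fun_prop : Continuous _).intervalIntegrable _ _)
      ((by fun_prop : Continuous _).intervalIntegrable _ _)]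
  congr 1
  ext x
  ring

lemma bdd1 (γ : ℝ) (hγ : 0 < γ) (W : Submodule ℝ (ℝ → ℝ)) (hW : Module.finrank ℝ W = 1 + 1)
    (ht : ∀ f ∈ W, IsTestFunDelta f) :
    BddAbove (range fun f : {f : ℝ → ℝ // f ∈ W ∧ f ≠ 0} => rayleighDelta γ f.1) := by
  haveI : FiniteDimensional ℝ W := Module.finite_of_finrank_pos (by omega)
  let B := Module.finBasisOfFinrankEq ℝ W (hW.trans (by norm_num : 1 + 1 = 2))
  set u : ℝ → ℝ := (B 0).1 with hu
  set v : ℝ → ℝ := (B 1).1 with hv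
  have hrep : ∀ f ∈ W, ∃ a b : ℝ, f = a • u + b • v := by
    intro f hf
    have := B.sum_repr ⟨f, hf⟩
    rw [Fin.sum_univ_two] at this
    exact ⟨_, _, (congrArg Subtype.val this).symm⟩
  have hind : ∀ a b : ℝ, a • u + b • v = 0 → a = 0 ∧ b = 0 := by
    intro a b hab
    have hli := B.linearIndependent
    rw [Fintype.linearIndependent_iff] at hli
    have := hli ![a, b] (by
      rw [Fin.sum_univ_two]
      apply Subtype.ext
      simpa using hab)
    exact ⟨by simpa using this 0, by simpa using this 1⟩
  have huW : u ∈ W := (B 0).2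
  have hvW : v ∈ W := (B 1).2
  have hut := ht u huW
  have hvt := ht v hvW
  have huc : Continuous u := hut.1.continuous
  have hvc : Continuous v := hvt.1.continuous
  have huc' : Continuous (deriv u) := hut.1.continuous_deriv (by simp)
  have hvc' : Continuous (deriv v) := hvt.1.continuous_deriv (by simp)
  have hud : Differentiable ℝ u := hut.1.differentiable (by simp)
  have hvd : Differentiable ℝ v := hvt.1.differentiable (by simp)
  have hDexp := quad_expand u v huc hvc
  have hEexp := quad_expand (deriv u) (deriv v) huc' hvc'
  have hd : ∀ a b x, deriv (a • u + b • v) x = a * deriv u x + b * deriv v x := by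
    intro a b x
    exact (((hud x).hasDerivAt.const_mul a).add ((hvd x).hasDerivAt.const_mul b)).deriv
  have hE2 : ∀ a b : ℝ, 0 ≤ ∫ x in (-(1/2) : ℝ)..(1/2), (a * deriv u x + b * deriv v x)^2 :=
    fun a b => intervalIntegral.integral_nonneg (by norm_num) (fun x _ => sq_nonneg _)
  have hDpos : ∀ a b : ℝ, ¬ (a = 0 ∧ b = 0) →
      0 < ∫ x in (-(1/2) : ℝ)..(1/2), (a * u x + b * v x)^2 := by
    intro a b hab
    exact D_pos (a • u + b • v) (ht _ (W.add_mem (W.smul_mem _ huW) (W.smul_mem _ hvW)))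
      (fun h => hab (hind a b h))
  have hEu := E_nonneg u
  have hEv := E_nonneg v
  set p := ∫ x in (-(1/2) : ℝ)..(1/2), (u x)^2
  set q := ∫ x in (-(1/2) : ℝ)..(1/2), u x * v x
  set r := ∫ x in (-(1/2) : ℝ)..(1/2), (v x)^2
  set p' := ∫ x in (-(1/2) : ℝ)..(1/2), (deriv u x)^2
  set q' := ∫ x in (-(1/2) : ℝ)..(1/2), deriv u x * deriv v x
  set r' := ∫ x in (-(1/2) : ℝ)..(1/2), (deriv v x)^2
  have hp : 0 < p := by
    have := hDpos 1 0 (by simp)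
    rw [hDexp] at this; linarith
  have hr : 0 < r := by
    have := hDpos 0 1 (by simp)
    rw [hDexp] at this; linarith
  have hdet : 0 < p * r - q^2 := by
    have := hDpos q (-p) (fun h => by linarith [h.2])
    rw [hDexp] at this
    have h2 : 0 < p * (p * r - q^2) := by linarith
    exact pos_of_mul_pos_right h2 hp.le
  refine ⟨2 * (p' + r' + γ * (u 0)^2 + γ * (v 0)^2) * ((p + r) / (p * r - q^2)), ?_⟩
  rintro _ ⟨⟨f, hf, hf0⟩, rfl⟩
  obtain ⟨a, b, rfl⟩ := hrep f hf
  have hab : ¬ (a = 0 ∧ b = 0) := by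
    rintro ⟨rfl, rfl⟩
    simp at hf0
  have hDp := hDpos a b hab
  unfold rayleighDelta
  simp only [hd]
  simp only [Pi.add_apply, Pi.smul_apply, smul_eq_mul]
  rw [div_le_iff₀ hDp, hDexp, hEexp]
  have hm := hE2 a (-b)
  rw [hEexp] at hm
  set K := p' + r' + γ * (u 0)^2 + γ * (v 0)^2 with hK
  have k1 : 0 ≤ γ * (u 0)^2 := by positivity
  have k2 : 0 ≤ γ * (v 0)^2 := by positivity
  have hK0 : 0 ≤ K := by linarith
  have hnum : a^2 * p' + 2 * a * b * q' + b^2 * r' + γ * (a * u 0 + b * v 0)^2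
      ≤ 2 * K * (a^2 + b^2) := by
    have j1 : γ * (a * u 0 + b * v 0)^2 ≤ γ * (2 * a^2 * (u 0)^2 + 2 * b^2 * (v 0)^2) := by
      apply mul_le_mul_of_nonneg_left _ hγ.le
      nlinarith [sq_nonneg (a * u 0 - b * v 0)]
    have j2 : 0 ≤ a^2 * r' := by positivity
    have j3 : 0 ≤ b^2 * p' := by positivity
    have j4 : 0 ≤ a^2 * (γ * (v 0)^2) := by positivity
    have j5 : 0 ≤ b^2 * (γ * (u 0)^2) := by positivity
    rw [hK]
    nlinarith
  have hden : (a^2 + b^2) ≤ (p + r) / (p * r - q^2) * (a^2 * p + 2 * a * b * q + b^2 * r) := by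
    rw [div_mul_eq_mul_div, le_div_iff₀ hdet]
    nlinarith [sq_nonneg (p * a + q * b), sq_nonneg (q * a + r * b)]
  calc _ ≤ 2 * K * (a^2 + b^2) := hnum
    _ ≤ 2 * K * ((p + r) / (p * r - q^2) * (a^2 * p + 2 * a * b * q + b^2 * r)) := by gcongr
    _ = _ := by ring

lemma ev_bddBelow (γ : ℝ) (hγ : 0 < γ) (n : ℕ) :
    BddBelow (range fun W : {W : Submodule ℝ (ℝ → ℝ) //
      Module.finrank ℝ (↥W) = n + 1 ∧ ∀ f ∈ W, IsTestFunDelta f} =>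
    ⨆ f : {f : ℝ → ℝ // f ∈ W.1 ∧ f ≠ 0}, rayleighDelta γ f.1) := by
  refine ⟨0, ?_⟩
  rintro _ ⟨W, rfl⟩
  exact Real.iSup_nonneg fun f => ray_nonneg γ hγ _

lemma ev_le (γ : ℝ) (hγ : 0 < γ) (n : ℕ) (M : ℝ) (hM : 0 ≤ M) (W : Submodule ℝ (ℝ → ℝ))
    (h1 : Module.finrank ℝ W = n + 1) (h2 : ∀ f ∈ W, IsTestFunDelta f)
    (h3 : ∀ f ∈ W, rayleighDelta γ f ≤ M) : deltaEV γ n ≤ M :=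
  (ciInf_le (ev_bddBelow γ hγ n) ⟨W, h1, h2⟩).trans
    (Real.iSup_le (fun f => h3 _ f.2.1) hM)

lemma sq_eps {a b : ℝ} (hb : 0 ≤ b) (h : ∀ ε : ℝ, 0 < ε → a ≤ (1 + ε)^2 * b) : a ≤ b := by
  have : Tendsto (fun ε : ℝ => (1 + ε)^2 * b) (nhdsWithin 0 (Ioi 0)) (nhds ((1 + 0)^2 * b)) :=
    ((by fun_prop : Continuous fun ε : ℝ => (1 + ε)^2 * b).tendsto 0).mono_left nhdsWithin_le_nhds
  have h2 := ge_of_tendsto this (by filter_upwards [self_mem_nhdsWithin] with ε hε using h ε hε)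
  simpa using h2

lemma ev0_le (γ : ℝ) (hγ : 0 < γ) : deltaEV γ 0 ≤ (2 * π - 2 / (γ + 2))^2 ∧
    ∃ W : Submodule ℝ (ℝ → ℝ), Module.finrank ℝ W = 0 + 1 ∧ (∀ f ∈ W, IsTestFunDelta f) := by
  have hpi := Real.pi_gt_three
  set d := 2 / (γ + 2) with hd
  have hd0 : 0 < d := by positivity
  have hd1 : d ≤ 1 := by rw [hd, div_le_one (by positivity)]; linarith
  have hdγ : d * γ ≤ 2 := by
    rw [hd, div_mul_eq_mul_div, div_le_iff₀ (by positivity)]; linarith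
  have hs : sin ((2 * π - d)/2) * (2 * (2 * π - d) * cos ((2 * π - d)/2)
      + γ * sin ((2 * π - d)/2)) ≤ 0 := by
    have e : (2 * π - d)/2 = π - d/2 := by ring
    rw [e, Real.cos_pi_sub, Real.sin_pi_sub]
    have h1 : 0 < sin (d/2) := Real.sin_pos_of_pos_of_lt_pi (by linarith) (by linarith)
    have h2 : sin (d/2) ≤ d/2 := Real.sin_le (by linarith)
    have h3 : 1 - (d/2)^2/2 ≤ cos (d/2) := Real.one_sub_sq_div_two_le_cos
    have h4 : 1/2 ≤ cos (d/2) := by nlinarith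
    have h5 : γ * sin (d/2) ≤ 1 := by nlinarith
    apply mul_nonpos_of_nonneg_of_nonpos h1.le
    nlinarith
  have key := fun ε hε => exists_W0 γ (2 * π - d) ε hγ hε (by linarith) (by linarith) hs
  constructor
  · apply sq_eps (sq_nonneg _)
    intro ε hε
    obtain ⟨W, h1, h2, h3⟩ := key ε hε
    exact ev_le γ hγ 0 _ (by positivity) W h1 h2 h3
  · obtain ⟨W, h1, h2, h3⟩ := key 1 one_pos
    exact ⟨W, h1, h2⟩

lemma ev1_eq (γ : ℝ) (hγ : 0 < γ) : deltaEV γ 1 = 4 * π^2 := by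
  apply le_antisymm
  · apply sq_eps (by positivity)
    intro ε hε
    obtain ⟨W, h1, h2, h3⟩ := exists_W1 γ ε hε
    exact ev_le γ hγ 1 _ (by positivity) W h1 h2 h3
  · obtain ⟨W₀, h1, h2, -⟩ := exists_W1 γ 1 one_pos
    haveI : Nonempty {W : Submodule ℝ (ℝ → ℝ) //
      Module.finrank ℝ (↥W) = 1 + 1 ∧ ∀ f ∈ W, IsTestFunDelta f} := ⟨⟨W₀, h1, h2⟩⟩
    apply le_ciInf
    rintro ⟨W, hW, ht⟩
    haveI : FiniteDimensional ℝ W := Module.finite_of_finrank_pos (by omega)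
    let ev : W →ₗ[ℝ] ℝ := (LinearMap.proj (0:ℝ)).comp W.subtype
    have hker : LinearMap.ker ev ≠ ⊥ := LinearMap.ker_ne_bot_of_finrank_lt (by simp [hW])
    obtain ⟨f, hf, hf0⟩ := Submodule.exists_mem_ne_zero_of_ne_bot hker
    have hf00 : f.1 0 = 0 := hf
    have hfne : f.1 ≠ 0 := fun h => hf0 (Subtype.ext h)
    exact (ray_lower_zero γ f.1 (ht _ f.2) hfne hf00).trans
      (le_ciSup (bdd1 γ hγ W hW ht) ⟨f.1, f.2, hfne⟩)

lemma exists_ne_W0 (W : Submodule ℝ (ℝ → ℝ)) (hW : Module.finrank ℝ W = 0 + 1) :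
    ∃ f : ℝ → ℝ, f ∈ W ∧ f ≠ 0 := by
  obtain ⟨v, hv, -⟩ := finrank_eq_one_iff'.1 hW
  exact ⟨v.1, v.2, fun h => hv (Subtype.ext h)⟩

lemma ev0_ge (γ : ℝ) (hγ : 8 ≤ γ) : 4 * π^2 - 32 * π^2 / γ ≤ deltaEV γ 0 := by
  obtain ⟨W₀, h1, h2⟩ := (ev0_le γ (by linarith)).2
  haveI : Nonempty {W : Submodule ℝ (ℝ → ℝ) //
    Module.finrank ℝ (↥W) = 0 + 1 ∧ ∀ f ∈ W, IsTestFunDelta f} := ⟨⟨W₀, h1, h2⟩⟩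
  apply le_ciInf
  rintro ⟨W, hW, ht⟩
  obtain ⟨f, hf, hf0⟩ := exists_ne_W0 W hW
  exact (ray_lower_gamma γ hγ f (ht _ hf) hf0).trans
    (le_ciSup (bdd0 γ W hW) ⟨f, hf, hf0⟩)

lemma ev0_mono (γ γ' : ℝ) (hγ : 0 < γ) (h : γ ≤ γ') : deltaEV γ 0 ≤ deltaEV γ' 0 := by
  apply ciInf_mono (ev_bddBelow γ hγ 0)
  rintro ⟨W, hW, ht⟩
  apply ciSup_mono (bdd0 γ' W hW)
  rintro ⟨f, hf, hf0⟩
  simp only [rayleighDelta]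
  have := D_nonneg f
  gcongr

lemma ev0_gap (γ : ℝ) (hγ : 0 < γ) : 2 / (γ + 2) ≤ 4 * π^2 - deltaEV γ 0 := by
  have hpi := Real.pi_gt_three
  have h := (ev0_le γ hγ).1
  set d := 2 / (γ + 2) with hd
  have hd0 : 0 < d := by positivity
  have hd1 : d ≤ 1 := by rw [hd, div_le_one (by positivity)]; linarith
  nlinarith

/-- for the Dirichlet Laplacian on `(-1/2,1/2)` with a `δ`-interaction of
strength `γ > 0` at `0`, the second eigenvalue equals `4π²` for all `γ`, the ground state
eigenvalue increases to `4π²`, and the spectral gap `λ₁(γ) − λ₀(γ) = 4π² − λ₀(γ)` behaves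
like `1/γ`: `c₁/γ ≤ 4π² − λ₀(γ) ≤ c₂/γ` for large `γ`. -/
theorem delta_interaction_gap_asymptotics :
    (∀ γ : ℝ, 0 < γ → deltaEV γ 1 = 4 * π ^ 2) ∧
    (MonotoneOn (fun γ => deltaEV γ 0) (Set.Ioi (0 : ℝ))) ∧
    (∀ γ : ℝ, 0 < γ → deltaEV γ 0 < 4 * π ^ 2) ∧
    Tendsto (fun γ => deltaEV γ 0) atTop (nhds (4 * π ^ 2)) ∧
    ∃ c₁ > 0, ∃ c₂ > 0, ∀ᶠ γ : ℝ in atTop,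
      c₁ / γ ≤ 4 * π ^ 2 - deltaEV γ 0 ∧ 4 * π ^ 2 - deltaEV γ 0 ≤ c₂ / γ := by
  have hlt : ∀ γ : ℝ, 0 < γ → deltaEV γ 0 < 4 * π ^ 2 := by
    intro γ hγ
    have h := ev0_gap γ hγ
    have : 0 < 2 / (γ + 2) := by positivity
    linarith
  refine ⟨ev1_eq, fun γ hγ γ' _ h => ev0_mono γ γ' hγ h, hlt, ?_, 1, one_pos, 32 * π^2,
    by positivity, ?_⟩
  · have h1 : Tendsto (fun γ : ℝ => 4 * π^2 - 32 * π^2 / γ) atTop (nhds (4 * π^2 - 0)) :=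
      tendsto_const_nhds.sub (tendsto_const_nhds.div_atTop tendsto_id)
    rw [sub_zero] at h1
    refine tendsto_of_tendsto_of_tendsto_of_le_of_le' h1 tendsto_const_nhds ?_ ?_
    · filter_upwards [eventually_ge_atTop 8] with γ hγ using ev0_ge γ hγ
    · filter_upwards [eventually_gt_atTop 0] with γ hγ using (hlt γ hγ).le
  · filter_upwards [eventually_ge_atTop 8] with γ hγ
    have hγ0 : 0 < γ := by linarith
    constructor
    · refine le_trans ?_ (ev0_gap γ hγ0)
      rw [div_le_div_iff₀ hγ0 (by positivity)]
      linarith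
    · linarith [ev0_ge γ hγ]
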